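/- arXiv:2406.13888 — 2 statements merged into one kernel-verified Lean document; each statement's English description precedes it below -/
import Mathlib

section
/- Let L > 0 and let (η_t)_{t≥0} be nonnegative stepsizes. Suppose there exist constants C > 0 and α > 1 such that for every convex L-smooth function f : ℝ → ℝ attaining its infimum at some x*, and every initialization x₀ ∈ ℝ, the gradient descent iterates satisfy f(x_T) − f(x*) ≤ C·L·(x₀ − x*)²/T^α for all T ≥ 1. Then every T ∈ ℕ with η_T ≥ 2/L and ∑_{t=0}^{T−1} η_t ≥ 1/L satisfies η_T ≤ √(32C) · (∑_{t=0}^{T−1} η_t) / (T+1)^{α/2}. -/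
/-- The one-sided Huber function: quadratic `L x² / 2` on `x ≤ 1`, affine with slope `L` beyond. -/
noncomputable def oneSidedHuber (L x : ℝ) : ℝ := ∫ t in (0 : ℝ)..x, L * min t 1

lemma hasDerivAt_oneSidedHuber (L x : ℝ) :
    HasDerivAt (oneSidedHuber L) (L * min x 1) x := by
  have hc : Continuous fun t : ℝ => L * min t 1 := by fun_prop
  exact intervalIntegral.integral_hasDerivAt_right (hc.intervalIntegrable _ _)
    hc.stronglyMeasurable.stronglyMeasurableAtFilter hc.continuousAt

lemma deriv_oneSidedHuber (L x : ℝ) : deriv (oneSidedHuber L) x = L * min x 1 :=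
  (hasDerivAt_oneSidedHuber L x).deriv

lemma differentiable_oneSidedHuber (L : ℝ) : Differentiable ℝ (oneSidedHuber L) :=
  fun x => (hasDerivAt_oneSidedHuber L x).differentiableAt

lemma convexOn_oneSidedHuber {L : ℝ} (hL : 0 ≤ L) :
    ConvexOn ℝ Set.univ (oneSidedHuber L) := by
  refine Monotone.convexOn_univ_of_deriv (differentiable_oneSidedHuber L) fun a b hab => ?_
  rw [deriv_oneSidedHuber, deriv_oneSidedHuber]
  gcongr

lemma abs_deriv_oneSidedHuber_sub_le {L : ℝ} (hL : 0 ≤ L) (y z : ℝ) :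
    |deriv (oneSidedHuber L) y - deriv (oneSidedHuber L) z| ≤ L * |y - z| := by
  rw [deriv_oneSidedHuber, deriv_oneSidedHuber, ← mul_sub, abs_mul, abs_of_nonneg hL]
  exact mul_le_mul_of_nonneg_left (by simpa using abs_min_sub_min_le_max y 1 z 1) hL

lemma oneSidedHuber_of_le_one (L : ℝ) {x : ℝ} (hx : x ≤ 1) :
    oneSidedHuber L x = L * x ^ 2 / 2 := by
  have h : oneSidedHuber L x = ∫ t in (0 : ℝ)..x, L * t := by
    refine intervalIntegral.integral_congr fun t ht => ?_
    have ht1 : t ≤ 1 := (Set.mem_uIcc.1 ht).elim (fun h => h.2.trans hx)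
      fun h => h.2.trans zero_le_one
    simp only [min_eq_left ht1]
  rw [h, intervalIntegral.integral_const_mul, integral_id]
  ring

lemma oneSidedHuber_zero (L : ℝ) : oneSidedHuber L 0 = 0 :=
  intervalIntegral.integral_same

lemma oneSidedHuber_nonneg {L : ℝ} (hL : 0 ≤ L) (x : ℝ) : 0 ≤ oneSidedHuber L x := by
  rcases le_total x 1 with hx | hx
  · rw [oneSidedHuber_of_le_one L hx]
    positivity
  · exact intervalIntegral.integral_nonneg (zero_le_one.trans hx) fun t ht =>
      mul_nonneg hL (le_min ht.1 zero_le_one)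

/-- Gradient descent stays on the affine piece of the Huber function until it reaches the kink. -/
lemma gd_oneSidedHuber_eq {L : ℝ} (hL : 0 ≤ L) {η x : ℕ → ℝ} (hη : ∀ t, 0 ≤ η t) {T : ℕ}
    (h0 : x 0 = 1 + L * ∑ t ∈ Finset.range T, η t)
    (hx : ∀ t, x (t + 1) = x t - η t * deriv (oneSidedHuber L) (x t)) :
    ∀ t ≤ T, x t = 1 + L * (∑ s ∈ Finset.range T, η s - ∑ s ∈ Finset.range t, η s) := by
  intro t
  induction t with
  | zero => intro _; simp [h0]
  | succ t ih =>
    intro ht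
    have hxt := ih (by omega)
    have hle : ∑ s ∈ Finset.range t, η s ≤ ∑ s ∈ Finset.range T, η s :=
      Finset.sum_le_sum_of_subset_of_nonneg (Finset.range_mono (by omega)) fun i _ _ => hη i
    have h1 : 1 ≤ x t := by
      rw [hxt]
      linarith [mul_nonneg hL (sub_nonneg.2 hle)]
    rw [hx, deriv_oneSidedHuber, min_eq_right h1, hxt, Finset.sum_range_succ]
    ring

/-- **Corollary 1 (anytime acceleration forbids overly long steps).**
If GD with nonnegative stepsizes `η` satisfies the anytime accelerated bound
`f (x T) - f x* ≤ C L (x₀ - x*)² / T^α` (for all `T ≥ 1`, uniformly over convex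
`L`-smooth `f`), then every `T` with `η T ≥ 2/L` and `∑_{t<T} η t ≥ 1/L` satisfies
`η T ≤ √(32 C) (∑_{t<T} η t) / (T+1)^(α/2)`. -/
theorem gd_anytime_acceleration_bounds_long_steps
    (L : ℝ) (hL : 0 < L) (η : ℕ → ℝ) (hη : ∀ t, 0 ≤ η t)
    (C α : ℝ) (hC : 0 < C) (hα : 1 < α)
    (hbound : ∀ f : ℝ → ℝ, ConvexOn ℝ Set.univ f → Differentiable ℝ f →
      (∀ y z : ℝ, |deriv f y - deriv f z| ≤ L * |y - z|) →
      ∀ xstar : ℝ, (∀ y : ℝ, f xstar ≤ f y) →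
      ∀ x₀ : ℝ, ∀ x : ℕ → ℝ, x 0 = x₀ →
        (∀ t : ℕ, x (t + 1) = x t - η t * deriv f (x t)) →
        ∀ T : ℕ, 1 ≤ T →
          f (x T) - f xstar ≤ C * L * (x₀ - xstar) ^ 2 / (T : ℝ) ^ α) :
    ∀ T : ℕ, 2 / L ≤ η T → 1 / L ≤ ∑ t ∈ Finset.range T, η t →
      η T ≤ Real.sqrt (32 * C) * (∑ t ∈ Finset.range T, η t) /
        ((T : ℝ) + 1) ^ (α / 2) := by
  intro T hT hS
  set S := ∑ t ∈ Finset.range T, η t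
  let x : ℕ → ℝ := fun n => Nat.rec (1 + L * S)
    (fun t y => y - η t * deriv (oneSidedHuber L) y) n
  have hxs : ∀ t, x (t + 1) = x t - η t * deriv (oneSidedHuber L) (x t) := fun _ => rfl
  have hxT : x T = 1 := by
    simpa using gd_oneSidedHuber_eq hL.le hη (T := T) (x := x) rfl hxs T le_rfl
  have hxT1 : x (T + 1) = 1 - L * η T := by
    rw [hxs, hxT, deriv_oneSidedHuber, min_self]
    ring
  have hLη : 2 ≤ L * η T := by
    rwa [div_le_iff₀' hL] at hT
  have hLS : 1 ≤ L * S := by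
    rwa [div_le_iff₀' hL] at hS
  have hb := hbound (oneSidedHuber L) (convexOn_oneSidedHuber hL.le)
    (differentiable_oneSidedHuber L) (abs_deriv_oneSidedHuber_sub_le hL.le) 0
    (fun y => (oneSidedHuber_zero L).trans_le (oneSidedHuber_nonneg hL.le y))
    (1 + L * S) x rfl hxs (T + 1) (by omega)
  rw [hxT1, oneSidedHuber_zero, sub_zero, sub_zero,
    oneSidedHuber_of_le_one L (by linarith)] at hb
  push_cast at hb
  have hpos : (0 : ℝ) < (T : ℝ) + 1 := by positivity
  have hsq : (((T : ℝ) + 1) ^ (α / 2)) ^ 2 = ((T : ℝ) + 1) ^ α := by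
    rw [← Real.rpow_natCast, ← Real.rpow_mul hpos.le]
    norm_num
  have hP : 0 < ((T : ℝ) + 1) ^ (α / 2) := Real.rpow_pos_of_pos hpos _
  rw [← hsq, le_div_iff₀ (by positivity)] at hb
  set P := ((T : ℝ) + 1) ^ (α / 2)
  have hS0 : 0 ≤ S := Finset.sum_nonneg fun i _ => hη i
  have hlow : (L * η T) ^ 2 / 4 ≤ (1 - L * η T) ^ 2 := by nlinarith
  have hupp : (1 + L * S) ^ 2 ≤ 4 * (L * S) ^ 2 := by nlinarith
  have hmain : L ^ 3 * (η T * P) ^ 2 ≤ L ^ 3 * (32 * C * S ^ 2) := by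
    have h1 : L * ((L * η T) ^ 2 / 4) / 2 * P ^ 2 ≤ L * (1 - L * η T) ^ 2 / 2 * P ^ 2 := by
      gcongr
    have h2 : C * L * (1 + L * S) ^ 2 ≤ C * L * (4 * (L * S) ^ 2) := by gcongr
    linarith
  rw [le_div_iff₀ hP]
  refine abs_le_of_sq_le_sq' ?_ (by positivity) |>.2
  rw [mul_pow (Real.sqrt _), Real.sq_sqrt (by positivity)]
  exact le_of_mul_le_mul_left hmain (by positivity)
end

section
/- Let (η_t)_{t≥0} be nonnegative stepsizes and φ : ℕ → ℝ. Let T ≥ 1 satisfy Σ_T := ∑_{t=0}^{T−1} η_t ≥ 1, η_t ≤ Σ_T/2 for all t < T, and suppose that for the function f_T(x) = x²/(2·Σ_T) the gradient descent iterates starting from x₀ = 1 satisfy f_T(x_T) ≤ φ(T). Then max_{0 ≤ t ≤ T−1} η_t ≥ e^{−4}/(2·T·φ(T)). -/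
/-- On `[0, 1/2]` the map `u ↦ 1 - u` dominates `u ↦ exp (-2u)`. -/
lemma exp_neg_two_mul_le_one_sub {u : ℝ} (h0 : 0 ≤ u) (h1 : u ≤ 1 / 2) :
    Real.exp (-(2 * u)) ≤ 1 - u := by
  rw [Real.exp_neg, inv_le_iff_one_le_mul₀ (Real.exp_pos _)]
  calc (1 : ℝ) ≤ (1 - u) * (2 * u + 1) := by nlinarith
    _ ≤ (1 - u) * Real.exp (2 * u) :=
      mul_le_mul_of_nonneg_left (Real.add_one_le_exp _) (by linarith)

/-- A sequence contracted by factors `1 - u t` with `u t ∈ [0, 1/2]` decays at most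
exponentially in the partial sums of `u`. -/
lemma exp_neg_two_mul_sum_le {u x : ℕ → ℝ} {T : ℕ} (h0 : ∀ t < T, 0 ≤ u t)
    (h1 : ∀ t < T, u t ≤ 1 / 2) (hx0 : x 0 = 1)
    (hx : ∀ t < T, x (t + 1) = x t * (1 - u t)) :
    Real.exp (-(2 * ∑ t ∈ Finset.range T, u t)) ≤ x T := by
  induction T with
  | zero => simp [hx0]
  | succ T ih =>
    have ihT := ih (fun t ht => h0 t (by omega)) (fun t ht => h1 t (by omega))
      (fun t ht => hx t (by omega))
    rw [hx T (by omega), Finset.sum_range_succ, mul_add, neg_add, Real.exp_add]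
    exact mul_le_mul ihT (exp_neg_two_mul_le_one_sub (h0 T (by omega)) (h1 T (by omega)))
      (Real.exp_pos _).le ((Real.exp_pos _).le.trans ihT)

/-- **Conclusion of the proof of Theorem 1.**
If `T ≥ 1`, `Σ_T = ∑_{t<T} η t ≥ 1`, `η t ≤ Σ_T / 2` for all `t < T`, and the GD
iterates on `f_T(x) = x² / (2 Σ_T)` from `x₀ = 1` satisfy `f_T (x T) ≤ φ T`, then
`max_{0 ≤ t ≤ T-1} η t ≥ e⁻⁴ / (2 T φ T)`. -/
theorem gd_quadratic_max_step_lower_bound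
    (η : ℕ → ℝ) (hη : ∀ t, 0 ≤ η t) (φ : ℕ → ℝ) (T : ℕ) (hT : 1 ≤ T)
    (hS : 1 ≤ ∑ t ∈ Finset.range T, η t)
    (hsmall : ∀ t < T, η t ≤ (∑ s ∈ Finset.range T, η s) / 2)
    (x : ℕ → ℝ) (hx0 : x 0 = 1)
    (hx : ∀ t : ℕ, x (t + 1) =
      x t - η t * deriv (fun y : ℝ => y ^ 2 / (2 * ∑ s ∈ Finset.range T, η s)) (x t))
    (hφ : (x T) ^ 2 / (2 * ∑ s ∈ Finset.range T, η s) ≤ φ T) :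
    Real.exp (-4) / (2 * T * φ T) ≤
      (Finset.range T).sup' (Finset.nonempty_range_iff.mpr (by omega)) η := by
  have hsup : ∑ t ∈ Finset.range T, η t ≤
      T * (Finset.range T).sup' (Finset.nonempty_range_iff.mpr (by omega)) η := by
    simpa using Finset.sum_le_card_nsmul (Finset.range T) η _
      (fun t ht => Finset.le_sup' η ht)
  set M := (Finset.range T).sup' (Finset.nonempty_range_iff.mpr (by omega)) η
  set S := ∑ t ∈ Finset.range T, η t with hSdef
  have hSpos : 0 < S := by linarith
  have hTpos : (0 : ℝ) < T := by exact_mod_cast hT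
  have hderiv (z : ℝ) : deriv (fun y : ℝ => y ^ 2 / (2 * S)) z = z / S := by
    simp only [deriv_div_const, deriv_pow_field]
    field_simp
    norm_num
  have hxT : Real.exp (-2) ≤ x T := by
    have h := exp_neg_two_mul_sum_le (u := fun t => η t / S) (x := x) (T := T)
      (fun t _ => div_nonneg (hη t) hSpos.le)
      (fun t ht => by
        rw [div_le_iff₀ hSpos]
        linarith [hsmall t ht])
      hx0 (fun t _ => by rw [hx t, hderiv]; ring)
    rwa [← Finset.sum_div, ← hSdef, div_self hSpos.ne', mul_one] at h
  have hexp : Real.exp (-4) ≤ x T ^ 2 := by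
    calc Real.exp (-4) = Real.exp (-2) ^ 2 := by rw [← Real.exp_nat_mul]; norm_num
      _ ≤ x T ^ 2 := by gcongr
  rw [div_le_iff₀ (by positivity)] at hφ
  have hφpos : 0 < φ T :=
    pos_of_mul_pos_left ((Real.exp_pos (-4)).trans_le (hexp.trans hφ)) (by positivity)
  rw [div_le_iff₀ (by positivity)]
  calc Real.exp (-4) ≤ φ T * (2 * S) := hexp.trans hφ
    _ ≤ φ T * (2 * (T * M)) := by gcongr
    _ = M * (2 * T * φ T) := by ring
end
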